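/- Let 𝒜 be a finite length, piecewise hereditary abelian category. Assume that there exist an integer r ≥ 1, ε = (ε₀,…,ε_{r−1}) ∈ {+1,−1}^r, and an indecomposable Q₀ of 𝒜 such that every SIMPLE object of 𝒜 is the end of an ε-path from Q₀. Then gldim 𝒜 ≤ r+1, and projd_𝒜 Q + injd_𝒜 Q ≤ r+2 for every indecomposable Q of 𝒜. -/

import Mathlib

open CategoryTheory CategoryTheory.Limits

universe w w' v u v' u'

namespace PiecewiseHereditaryPaper

variable (𝒜 : Type u) [Category.{v} 𝒜] [Abelian 𝒜] [HasDerivedCategory.{w} 𝒜]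

/-- `Ext^d_𝒜(X,Y) ≠ 0`, where `Ext^d` is computed as
`Hom_{D(𝒜)}(X[0], Y[0][d])`. -/
def extNonzero (X Y : 𝒜) (d : ℤ) : Prop :=
  ∃ g : (DerivedCategory.singleFunctor 𝒜 0).obj X ⟶
      (((DerivedCategory.singleFunctor 𝒜 0).obj Y)⟦d⟧), g ≠ 0

/-- The projective dimension `projd_𝒜 Q = sup {d : Ext^d_𝒜(Q,Q') ≠ 0 for some Q'}`,
as an element of `ℕ∞` (the empty sup being `0`). -/
noncomputable def projDim (Q : 𝒜) : ℕ∞ :=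
  ⨆ (d : ℕ) (_ : ∃ Q' : 𝒜, extNonzero 𝒜 Q Q' d), (d : ℕ∞)

/-- The injective dimension `injd_𝒜 Q = sup {d : Ext^d_𝒜(Q',Q) ≠ 0 for some Q'}`. -/
noncomputable def injDim (Q : 𝒜) : ℕ∞ :=
  ⨆ (d : ℕ) (_ : ∃ Q' : 𝒜, extNonzero 𝒜 Q' Q d), (d : ℕ∞)

/-- The global dimension `gldim 𝒜 = sup_Q projd_𝒜 Q`. -/
noncomputable def gldim : ℕ∞ := ⨆ Q : 𝒜, projDim 𝒜 Q

/-- An abelian category is hereditary if `Ext^d` vanishes for all `d ≥ 2`. -/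
def Hereditary : Prop := ∀ (X Y : 𝒜) (d : ℕ), 2 ≤ d → ¬ extNonzero 𝒜 X Y (d : ℤ)

/-- An abelian category has finite length if every object has a (finite)
composition series, i.e. a finite maximal chain of subobjects from `⊥` to `⊤`. -/
def FiniteLength : Prop :=
  ∀ X : 𝒜, ∃ (n : ℕ) (f : Fin (n + 1) → Subobject X),
    f 0 = ⊥ ∧ f (Fin.last n) = ⊤ ∧ ∀ i : Fin n, f i.castSucc ⋖ f i.succ

/-- A triangulated equivalence `D(𝒜) ≃ D(ℋ)`: an equivalence of categories
commuting with the shift and preserving distinguished triangles. -/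
structure TriangulatedEquivalence (ℋ : Type u') [Category.{v'} ℋ] [Abelian ℋ]
    [HasDerivedCategory.{w'} ℋ] where
  functor : DerivedCategory 𝒜 ⥤ DerivedCategory ℋ
  isEquivalence : functor.IsEquivalence
  commShift : functor.CommShift ℤ
  isTriangulated : letI := commShift; functor.IsTriangulated

/-- `𝒜` is piecewise hereditary if there are a hereditary abelian category `ℋ`
and a triangulated equivalence `D(𝒜) ≃ D(ℋ)`. -/
def IsPiecewiseHereditary : Prop :=
  ∃ (ℋ : Type u') (_ : Category.{v'} ℋ) (_ : Abelian ℋ) (_ : HasDerivedCategory.{w'} ℋ),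
    Hereditary ℋ ∧ Nonempty (TriangulatedEquivalence 𝒜 ℋ)

/-- An `ε`-path from `Q` to `Q'` in the graph `G(𝒜)` of indecomposables of `𝒜`
(edges `X → Y` whenever `Hom_𝒜(X,Y) ≠ 0`). -/
def EpsPath {r : ℕ} (ε : Fin r → ℤ) (Q Q' : 𝒜) : Prop :=
  ∃ c : Fin (r + 1) → 𝒜,
    c 0 = Q ∧ c (Fin.last r) = Q' ∧ (∀ i, Indecomposable (c i)) ∧
    ∀ i : Fin r,
      (ε i = 1 → ∃ g : c i.castSucc ⟶ c i.succ, g ≠ 0) ∧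
      (ε i = -1 → ∃ g : c i.succ ⟶ c i.castSucc, g ≠ 0)


section Tri

open Pretriangulated

variable {C : Type*} [Category C] [HasZeroObject C] [HasShift C ℤ] [Preadditive C]
  [∀ n : ℤ, (shiftFunctor C n).Additive] [Pretriangulated C]
  {X Y Z N : C} {f : X ⟶ Y} {g : Y ⟶ Z} {h : Z ⟶ X⟦(1 : ℤ)⟧}

lemma yo2 (hT : Triangle.mk f g h ∈ distTriang C) (k : Y ⟶ N) (hk : f ≫ k = 0) :
    ∃ l : Z ⟶ N, k = g ≫ l := Triangle.yoneda_exact₂ _ hT k hk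

lemma yo3 (hT : Triangle.mk f g h ∈ distTriang C) (k : Z ⟶ N) (hk : g ≫ k = 0) :
    ∃ l : X⟦(1 : ℤ)⟧ ⟶ N, k = h ≫ l := Triangle.yoneda_exact₃ _ hT k hk

lemma yo1 (hT : Triangle.mk f g h ∈ distTriang C) (k : X⟦(1 : ℤ)⟧ ⟶ N) (hk : h ≫ k = 0) :
    ∃ l : Y⟦(1 : ℤ)⟧ ⟶ N, k = f⟦(1 : ℤ)⟧' ≫ l := by
  obtain ⟨l, hl⟩ : ∃ l : Y⟦(1 : ℤ)⟧ ⟶ N, k = (-f⟦(1 : ℤ)⟧') ≫ l :=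
    Triangle.yoneda_exact₂ _ (rot_of_distTriang _ (rot_of_distTriang _ hT)) k hk
  exact ⟨-l, by rw [hl]; simp⟩

lemma coyo2 (hT : Triangle.mk f g h ∈ distTriang C) (k : N ⟶ Y) (hk : k ≫ g = 0) :
    ∃ l : N ⟶ X, k = l ≫ f := Triangle.coyoneda_exact₂ _ hT k hk

lemma coyo3 (hT : Triangle.mk f g h ∈ distTriang C) (k : N ⟶ Z) (hk : k ≫ h = 0) :
    ∃ l : N ⟶ Y, k = l ≫ g := Triangle.coyoneda_exact₃ _ hT k hk

lemma coyo_shift (hT : Triangle.mk f g h ∈ distTriang C) (k : N ⟶ Z⟦(1 : ℤ)⟧)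
    (hk : k ≫ h⟦(1 : ℤ)⟧' = 0) :
    ∃ l : N ⟶ Y⟦(1 : ℤ)⟧, k = l ≫ g⟦(1 : ℤ)⟧' := by
  obtain ⟨l, hl⟩ : ∃ l : N ⟶ Y⟦(1 : ℤ)⟧, k = l ≫ (-g⟦(1 : ℤ)⟧') :=
    Triangle.coyoneda_exact₃ _ (rot_of_distTriang _ (rot_of_distTriang _
      (rot_of_distTriang _ hT))) k (by
        change k ≫ (-h⟦(1 : ℤ)⟧') = 0
        rw [Preadditive.comp_neg, hk, neg_zero])
  exact ⟨-l, by rw [hl]; simp⟩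

lemma coyo1 (hT : Triangle.mk f g h ∈ distTriang C) (k : N ⟶ X) (hk : k ≫ f = 0) :
    ∃ (l : N ⟶ Z⟦(-1 : ℤ)⟧) (m : Z⟦(-1 : ℤ)⟧ ⟶ X), k = l ≫ m := by
  obtain ⟨l, hl⟩ := Triangle.coyoneda_exact₂ _ (inv_rot_of_distTriang _ hT) k hk
  exact ⟨l, _, hl⟩

lemma compl2 {X' Y' Z' : C} {f' : X' ⟶ Y'} {g' : Y' ⟶ Z'} {h' : Z' ⟶ X'⟦(1 : ℤ)⟧}
    (hT : Triangle.mk f g h ∈ distTriang C) (hT' : Triangle.mk f' g' h' ∈ distTriang C)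
    (a : X ⟶ X') (c : Z ⟶ Z') (comm : h ≫ a⟦(1 : ℤ)⟧' = c ≫ h') :
    ∃ b : Y ⟶ Y', f ≫ b = a ≫ f' ∧ g ≫ c = b ≫ g' :=
  complete_distinguished_triangle_morphism₂ _ _ hT hT' a c comm

end Tri

section Core

open Pretriangulated DerivedCategory

variable {ℋ : Type u'} [Category.{v'} ℋ] [Abelian ℋ] [HasDerivedCategory.{w'} ℋ]

lemma hom_shift_range (hH : Hereditary ℋ) {X Y : ℋ} {n m : ℤ}
    (f : ((singleFunctor ℋ 0).obj X)⟦n⟧ ⟶ ((singleFunctor ℋ 0).obj Y)⟦m⟧) (hf : f ≠ 0) :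
    n ≤ m ∧ m ≤ n + 1 := by
  constructor
  · by_contra h
    have h1 : TStructure.t.IsLE (((singleFunctor ℋ 0).obj X)⟦n⟧) (-n) :=
      TStructure.t.isLE_shift _ 0 n (-n) (by lia)
    have h2 : TStructure.t.IsGE (((singleFunctor ℋ 0).obj Y)⟦m⟧) (-m) :=
      TStructure.t.isGE_shift _ 0 m (-m) (by lia)
    exact hf (TStructure.t.zero_of_isLE_of_isGE f (-n) (-m) (by lia) h1 h2)
  · by_contra h
    obtain ⟨d, hd⟩ : ∃ d : ℕ, (d : ℤ) = m - n := ⟨(m - n).toNat, by lia⟩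
    let e := (shiftFunctorAdd' (DerivedCategory ℋ) (d : ℤ) n m (by lia)).app
      ((singleFunctor ℋ 0).obj Y)
    obtain ⟨g, hg⟩ := (shiftFunctor (DerivedCategory ℋ) n).map_surjective (f ≫ e.hom)
    refine hH X Y d (by lia) ⟨g, ?_⟩
    rintro rfl
    apply hf
    rw [← cancel_mono e.hom, ← hg]
    simp

lemma ext_two_zero (hH : Hereditary ℋ) {X Y : ℋ}
    (f : (singleFunctor ℋ 0).obj X ⟶ (((singleFunctor ℋ 0).obj Y)⟦(1 : ℤ)⟧)⟦(1 : ℤ)⟧) :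
    f = 0 := by
  let e := (shiftFunctorAdd' (DerivedCategory ℋ) (1 : ℤ) 1 2 (by lia)).app
      ((singleFunctor ℋ 0).obj Y)
  by_contra hf
  refine hH X Y 2 le_rfl ⟨f ≫ e.inv, ?_⟩
  intro h
  apply hf
  rw [← cancel_mono e.inv]
  exact h.trans (by simp)


lemma ses_triangle {X Y Z : ℋ} (f : X ⟶ Y) (g : Y ⟶ Z) (w : f ≫ g = 0)
    (hS : (ShortComplex.mk f g w).ShortExact) :
    ∃ δ : (singleFunctor ℋ 0).obj Z ⟶ ((singleFunctor ℋ 0).obj X)⟦(1 : ℤ)⟧,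
      Triangle.mk ((singleFunctor ℋ 0).map f) ((singleFunctor ℋ 0).map g) δ ∈
        distTriang (DerivedCategory ℋ) :=
  ⟨hS.singleδ, hS.singleTriangle_distinguished⟩

lemma core_left (hH : Hereditary ℋ) {x B z h : ℋ} (a : x ⟶ B) [Epi a] (b : B ⟶ z) (p : z ⟶ h)
    (w : b ≫ p = 0) (hS : (ShortComplex.mk b p w).ShortExact) {N : DerivedCategory ℋ}
    (k : (singleFunctor ℋ 0).obj z ⟶ N) (hk : (singleFunctor ℋ 0).map (a ≫ b) ≫ k = 0) :
    ∃ (E : DerivedCategory ℋ) (i : (singleFunctor ℋ 0).obj x ⟶ E)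
      (q : E ⟶ (singleFunctor ℋ 0).obj h)
      (e : (singleFunctor ℋ 0).obj h ⟶ ((singleFunctor ℋ 0).obj x)⟦(1 : ℤ)⟧)
      (u : E ⟶ (singleFunctor ℋ 0).obj z) (ψ : (singleFunctor ℋ 0).obj h ⟶ N),
      Triangle.mk i q e ∈ distTriang (DerivedCategory ℋ) ∧
      u ≫ (singleFunctor ℋ 0).map p = q ∧ q ≫ ψ = u ≫ k := by
  have hS2 : (ShortComplex.mk (kernel.ι a) a (kernel.condition a)).ShortExact :=
    { exact := ShortComplex.exact_of_f_is_kernel _ (kernelIsKernel a) }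
  obtain ⟨δ, T1⟩ := ses_triangle _ _ _ hS
  obtain ⟨δ₂, T2⟩ := ses_triangle _ _ _ hS2
  obtain ⟨g, hg⟩ := coyo_shift T2 δ (ext_two_zero hH _)
  obtain ⟨E, i, q, T3⟩ := distinguished_cocone_triangle₂ g
  obtain ⟨u, hu1, hu2⟩ := compl2 T3 T1 ((singleFunctor ℋ 0).map a) (𝟙 _) (by
      rw [← hg, Category.id_comp])
  obtain ⟨ψ, hψ⟩ := yo2 T3 (u ≫ k) (by
    rw [← Category.assoc, hu1, ← Functor.map_comp, hk])
  exact ⟨E, i, q, g, u, ψ, T3, by rw [← hu2, Category.comp_id], hψ.symm⟩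

lemma core_right (hH : Hereditary ℋ) {h z B x : ℋ} (p : h ⟶ z) (b : z ⟶ B) (a : B ⟶ x) [Mono a]
    (w : p ≫ b = 0) (hS : (ShortComplex.mk p b w).ShortExact) {N : DerivedCategory ℋ}
    (k : N ⟶ (singleFunctor ℋ 0).obj z) (hk : k ≫ (singleFunctor ℋ 0).map (b ≫ a) = 0) :
    ∃ (E : DerivedCategory ℋ) (q : (singleFunctor ℋ 0).obj h ⟶ E)
      (i : E ⟶ (singleFunctor ℋ 0).obj x)
      (e : (singleFunctor ℋ 0).obj x ⟶ ((singleFunctor ℋ 0).obj h)⟦(1 : ℤ)⟧)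
      (u : (singleFunctor ℋ 0).obj z ⟶ E) (ψ : N ⟶ (singleFunctor ℋ 0).obj h),
      Triangle.mk q i e ∈ distTriang (DerivedCategory ℋ) ∧
      (singleFunctor ℋ 0).map p ≫ u = q ∧ ψ ≫ q = k ≫ u := by
  have hS2 : (ShortComplex.mk a (cokernel.π a) (cokernel.condition a)).ShortExact :=
    { exact := ShortComplex.exact_of_g_is_cokernel _ (cokernelIsCokernel a) }
  obtain ⟨δ, T1⟩ := ses_triangle _ _ _ hS
  obtain ⟨δ₂, T2⟩ := ses_triangle _ _ _ hS2
  obtain ⟨g', hg'⟩ := yo1 T2 (δ⟦(1 : ℤ)⟧') (ext_two_zero hH _)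
  obtain ⟨g, rfl⟩ := (shiftFunctor (DerivedCategory ℋ) (1 : ℤ)).map_surjective g'
  have hg : δ = (singleFunctor ℋ 0).map a ≫ g := by
    apply (shiftFunctor (DerivedCategory ℋ) (1 : ℤ)).map_injective
    rw [hg', Functor.map_comp]
  obtain ⟨E, q, i, T3⟩ := distinguished_cocone_triangle₂ g
  obtain ⟨u, hu1, hu2⟩ := compl2 T1 T3 (𝟙 _) ((singleFunctor ℋ 0).map a) (by
      rw [hg]; simp)
  obtain ⟨ψ, hψ⟩ := coyo2 T3 (k ≫ u) (by
    rw [Category.assoc, ← hu2, ← Functor.map_comp, hk])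
  exact ⟨E, q, i, g, u, ψ, T3, by rw [hu1, Category.id_comp], hψ.symm⟩

lemma core_split {x h x' : ℋ} {E E' : DerivedCategory ℋ}
    {i : (singleFunctor ℋ 0).obj x ⟶ E} {q : E ⟶ (singleFunctor ℋ 0).obj h}
    {e : (singleFunctor ℋ 0).obj h ⟶ ((singleFunctor ℋ 0).obj x)⟦(1 : ℤ)⟧}
    (hT : Triangle.mk i q e ∈ distTriang (DerivedCategory ℋ))
    {q' : (singleFunctor ℋ 0).obj h ⟶ E'} {i' : E' ⟶ (singleFunctor ℋ 0).obj x'}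
    {e' : (singleFunctor ℋ 0).obj x' ⟶ ((singleFunctor ℋ 0).obj h)⟦(1 : ℤ)⟧}
    (hT' : Triangle.mk q' i' e' ∈ distTriang (DerivedCategory ℋ))
    (t : (singleFunctor ℋ 0).obj h ⟶ (singleFunctor ℋ 0).obj h) (ht : q ≫ t ≫ q' = 0) :
    t = 0 := by
  have h1 : TStructure.t.IsLE (((singleFunctor ℋ 0).obj x)⟦(1 : ℤ)⟧) (-1) :=
    TStructure.t.isLE_shift _ 0 1 (-1) (by lia)
  have h2 : TStructure.t.IsGE (((singleFunctor ℋ 0).obj x')⟦(-1 : ℤ)⟧) 1 :=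
    TStructure.t.isGE_shift _ 0 (-1) 1 (by lia)
  have h3 : t ≫ q' = 0 := by
    obtain ⟨g, hg⟩ := yo3 hT (t ≫ q') ht
    obtain ⟨g', hg'⟩ := coyo2 hT' g
      (TStructure.t.zero_of_isLE_of_isGE _ (-1) 0 (by lia) h1 inferInstance)
    rw [hg, hg', TStructure.t.zero_of_isLE_of_isGE g' (-1) 0 (by lia) h1 inferInstance]
    simp
  obtain ⟨s, m, hs⟩ := coyo1 hT' t h3
  rw [hs, TStructure.t.zero_of_isLE_of_isGE s 0 1 (by lia) inferInstance h2]
  simp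

lemma complex_split (hH : Hereditary ℋ) (K : CochainComplex ℋ ℤ) :
    ∃ (ψ : (singleFunctor ℋ 0).obj (K.homology 0) ⟶ Q.obj K)
      (φ : Q.obj K ⟶ (singleFunctor ℋ 0).obj (K.homology 0)), ψ ≫ φ = 𝟙 _ := by
  have r1 : (ComplexShape.up ℤ).Rel (-1) 0 := by simp
  have r2 : (ComplexShape.up ℤ).Rel 0 1 := by simp
  -- the chain maps from the cycles and to the opcycles
  let k : (HomologicalComplex.single ℋ (ComplexShape.up ℤ) 0).obj (K.cycles 0) ⟶ K :=
    HomologicalComplex.mkHomFromSingle (K.iCycles 0) (fun j _ => by simp)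
  let k' : K ⟶ (HomologicalComplex.single ℋ (ComplexShape.up ℤ) 0).obj (K.opcycles 0) :=
    HomologicalComplex.mkHomToSingle (K.pOpcycles 0) (fun j _ => by simp)
  have hkk : k ≫ k' = (HomologicalComplex.single ℋ (ComplexShape.up ℤ) 0).map
      (K.homologyπ 0 ≫ K.homologyι 0) := by
    apply HomologicalComplex.from_single_hom_ext
    simp [k, k', HomologicalComplex.single_map_f_self]
  have hk0 : Q.map ((HomologicalComplex.single ℋ (ComplexShape.up ℤ) 0).map
      (K.toCycles (-1) 0) ≫ k) = 0 := by
    let hh : ∀ i j, (ComplexShape.up ℤ).Rel j i →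
        (((HomologicalComplex.single ℋ (ComplexShape.up ℤ) 0).obj (K.X (-1))).X i ⟶ K.X j) :=
      fun i j _ => if h : i = 0 ∧ j = -1 then
        (HomologicalComplex.XIsoOfEq _ h.1).hom ≫
          (HomologicalComplex.singleObjXSelf (ComplexShape.up ℤ) 0 (K.X (-1))).hom ≫
          (K.XIsoOfEq h.2).inv else 0
    have e : (HomologicalComplex.single ℋ (ComplexShape.up ℤ) 0).map (K.toCycles (-1) 0) ≫ k =
        Homotopy.nullHomotopicMap' hh := by
      apply HomologicalComplex.from_single_hom_ext
      rw [Homotopy.nullHomotopicMap'_f r1 r2]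
      simp [k, hh, HomologicalComplex.single_map_f_self, HomologicalComplex.XIsoOfEq_rfl]
    rw [e, Q_map_eq_of_homotopy _ (Homotopy.nullHomotopy' hh), Functor.map_zero]
  have hk0' : Q.map (k' ≫ (HomologicalComplex.single ℋ (ComplexShape.up ℤ) 0).map
      (K.fromOpcycles 0 1)) = 0 := by
    let hh : ∀ i j, (ComplexShape.up ℤ).Rel j i →
        (K.X i ⟶ ((HomologicalComplex.single ℋ (ComplexShape.up ℤ) 0).obj (K.X 1)).X j) :=
      fun i j _ => if h : i = 1 ∧ j = 0 then
        (K.XIsoOfEq h.1).hom ≫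
          (HomologicalComplex.singleObjXSelf (ComplexShape.up ℤ) 0 (K.X 1)).inv ≫
          (HomologicalComplex.XIsoOfEq _ h.2).inv else 0
    have e : k' ≫ (HomologicalComplex.single ℋ (ComplexShape.up ℤ) 0).map (K.fromOpcycles 0 1) =
        Homotopy.nullHomotopicMap' hh := by
      apply HomologicalComplex.to_single_hom_ext
      rw [Homotopy.nullHomotopicMap'_f r1 r2]
      simp [k', hh, HomologicalComplex.single_map_f_self, HomologicalComplex.XIsoOfEq_rfl]
    rw [e, Q_map_eq_of_homotopy _ (Homotopy.nullHomotopy' hh), Functor.map_zero]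
  -- the short exact sequences
  have ex1 : (ShortComplex.mk (K.toCycles (-1) 0) (K.homologyπ 0) (by simp)).Exact :=
    ShortComplex.exact_of_g_is_cokernel _ (K.homologyIsCokernel (-1) 0 (by simp))
  have ex2 : (ShortComplex.mk (K.homologyι 0) (K.fromOpcycles 0 1) (by simp)).Exact :=
    ShortComplex.exact_of_f_is_kernel _ (K.homologyIsKernel 0 1 (by simp))
  let a := kernel.lift (K.homologyπ 0) (K.toCycles (-1) 0) (by simp)
  have : Epi a := (ShortComplex.exact_iff_epi_kernel_lift _).1 ex1
  let a' := cokernel.desc (K.homologyι 0) (K.fromOpcycles 0 1) (by simp)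
  have : Mono a' := (ShortComplex.exact_iff_mono_cokernel_desc _).1 ex2
  have hS1 : (ShortComplex.mk (kernel.ι (K.homologyπ 0)) (K.homologyπ 0)
      (kernel.condition _)).ShortExact :=
    { exact := ShortComplex.exact_of_f_is_kernel _ (kernelIsKernel _) }
  have hS2 : (ShortComplex.mk (K.homologyι 0) (cokernel.π (K.homologyι 0))
      (cokernel.condition _)).ShortExact :=
    { exact := ShortComplex.exact_of_g_is_cokernel _ (cokernelIsCokernel _) }
  let κ : (singleFunctor ℋ 0).obj (K.cycles 0) ⟶ Q.obj K := Q.map k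
  let κ' : Q.obj K ⟶ (singleFunctor ℋ 0).obj (K.opcycles 0) := Q.map k'
  have hκ : (singleFunctor ℋ 0).map (a ≫ kernel.ι (K.homologyπ 0)) ≫ κ = 0 := by
    have : a ≫ kernel.ι (K.homologyπ 0) = K.toCycles (-1) 0 := by simp [a]
    rw [this]
    rw [Functor.map_comp] at hk0
    exact hk0
  have hκ' : κ' ≫ (singleFunctor ℋ 0).map (cokernel.π (K.homologyι 0) ≫ a') = 0 := by
    have : cokernel.π (K.homologyι 0) ≫ a' = K.fromOpcycles 0 1 := by simp [a']
    rw [this]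
    rw [Functor.map_comp] at hk0'
    exact hk0'
  have hκκ : κ ≫ κ' = (singleFunctor ℋ 0).map (K.homologyπ 0) ≫
      (singleFunctor ℋ 0).map (K.homologyι 0) := by
    rw [← Functor.map_comp]
    have := congrArg Q.map hkk
    rw [Functor.map_comp] at this
    exact this
  obtain ⟨E, i, q, e, u, ψ, T, hu, hψ⟩ := core_left hH a _ _ _ hS1 κ hκ
  obtain ⟨E', q', i', e', u', φ, T', hu', hφ⟩ := core_right hH _ _ a' _ hS2 κ' hκ'
  refine ⟨ψ, φ, ?_⟩
  rw [← sub_eq_zero]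
  apply core_split T T'
  rw [Preadditive.sub_comp, Preadditive.comp_sub, sub_eq_zero, Category.assoc, hφ,
    reassoc_of% hψ, reassoc_of% hκκ, hu', reassoc_of% hu, Category.id_comp]

lemma exists_iso_shift (hH : Hereditary ℋ) (M : DerivedCategory ℋ)
    (hM : ¬ IsZero M) (hid : ∀ e : M ⟶ M, e ≫ e = e → e = 0 ∨ e = 𝟙 M) :
    ∃ (n : ℤ) (H : ℋ), Nonempty (M ≅ ((singleFunctor ℋ 0).obj H)⟦n⟧) := by
  obtain ⟨n, hn⟩ : ∃ n : ℤ, ¬ IsZero ((homologyFunctor ℋ n).obj M) := by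
    by_contra! hcon
    apply hM
    have : IsIso (0 : M ⟶ M) := by
      rw [isIso_iff]
      intro n
      exact ⟨0, (hcon n).eq_of_src _ _, (hcon n).eq_of_src _ _⟩
    rw [IsZero.iff_id_eq_zero, ← cancel_epi (0 : M ⟶ M)]; simp
  let K := Q.objPreimage (M⟦n⟧)
  let e : Q.obj K ≅ M⟦n⟧ := Q.objObjPreimageIso (M⟦n⟧)
  have hK : ¬ IsZero (K.homology 0) := by
    intro h
    apply hn
    refine h.of_iso ?_
    exact (((homologyFunctor ℋ 0).shiftIso n 0 n (by lia)).app M).symm ≪≫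
      (homologyFunctor ℋ 0).mapIso e.symm ≪≫ (homologyFunctorFactors ℋ 0).app K
  obtain ⟨ψ, φ, h⟩ := complex_split hH K
  obtain ⟨p, hp⟩ := (shiftFunctor (DerivedCategory ℋ) n).map_surjective
    (e.inv ≫ φ ≫ ψ ≫ e.hom)
  have hp2 : p ≫ p = p := by
    apply (shiftFunctor (DerivedCategory ℋ) n).map_injective
    rw [Functor.map_comp, hp]
    simp [reassoc_of% h]
  have hp1 : p = 𝟙 M := by
    rcases hid p hp2 with h0 | h1
    · exfalso
      rw [h0, Functor.map_zero] at hp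
      have h1 : φ ≫ ψ = 0 := by
        have := congrArg (fun t => e.hom ≫ t ≫ e.inv) hp.symm
        simpa using this
      apply hK
      rw [IsZero.iff_id_eq_zero]
      apply (singleFunctor ℋ 0).map_injective
      rw [CategoryTheory.Functor.map_id, Functor.map_zero, ← h]
      calc ψ ≫ φ = (ψ ≫ φ) ≫ ψ ≫ φ := by rw [h]; simp
        _ = ψ ≫ (φ ≫ ψ) ≫ φ := by simp only [Category.assoc]
        _ = 0 := by rw [h1]; simp
    · exact h1
  have h2 : φ ≫ ψ = 𝟙 _ := by
    rw [hp1, CategoryTheory.Functor.map_id] at hp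
    have := congrArg (fun t => e.hom ≫ t ≫ e.inv) hp.symm
    simpa using this
  let i : (singleFunctor ℋ 0).obj (K.homology 0) ≅ M⟦n⟧ := ⟨ψ, φ, h, h2⟩ ≪≫ e
  exact ⟨-n, K.homology 0, ⟨(shiftEquiv (DerivedCategory ℋ) n).unitIso.app M ≪≫
    (shiftFunctor (DerivedCategory ℋ) (-n)).mapIso i.symm⟩⟩

end Core
section Indec

variable {C : Type*} [Category C] [Abelian C]

lemma idem_of_indecomposable {X : C} (hX : Indecomposable X) (e : X ⟶ X) (he : e ≫ e = e) :
    e = 0 ∨ e = 𝟙 X := by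
  obtain ⟨Y, i, p, hip, hpi⟩ := IsIdempotentComplete.idempotents_split X e he
  obtain ⟨Z, j, q, hjq, hqj⟩ := IsIdempotentComplete.idempotents_split X (𝟙 X - e)
    (by simp [he])
  have hjp : j ≫ p = 0 := by
    calc j ≫ p = (j ≫ q) ≫ j ≫ p ≫ i ≫ p := by rw [hjq, hip]; simp
      _ = j ≫ (q ≫ j) ≫ (p ≫ i) ≫ p := by simp only [Category.assoc]
      _ = 0 := by rw [hqj, hpi, ← Category.assoc (𝟙 X - e)]; simp [he]
  have hiq : i ≫ q = 0 := by
    calc i ≫ q = (i ≫ p) ≫ i ≫ q ≫ j ≫ q := by rw [hjq, hip]; simp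
      _ = i ≫ (p ≫ i) ≫ (q ≫ j) ≫ q := by simp only [Category.assoc]
      _ = 0 := by rw [hqj, hpi, ← Category.assoc e]; simp [he]
  have iso : X ≅ Y ⊞ Z :=
    { hom := biprod.lift p q
      inv := biprod.desc i j
      hom_inv_id := by rw [biprod.lift_desc, hpi, hqj]; simp
      inv_hom_id := by
        ext <;> simp [hip, hjq, hjp, hiq] }
  rcases hX.2 Y Z iso with h | h
  · left
    rw [← hpi, h.eq_of_src i 0, comp_zero]
  · right
    have : 𝟙 X - e = 0 := by rw [← hqj, h.eq_of_src j 0, comp_zero]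
    exact (sub_eq_zero.1 this).symm

lemma simple_cokernel_of_covBy {X : C} {A B : Subobject X} (h : A ⋖ B) :
    Simple (cokernel (Subobject.ofLE A B h.le)) := by
  set π := cokernel.π (Subobject.ofLE A B h.le) with hπ
  refine ⟨fun {W} g _ => ⟨fun hg h0 => ?_, fun hg => ?_⟩⟩
  · subst h0
    have hz : π = 0 := by
      rw [← cancel_mono (inv (0 : W ⟶ cokernel (Subobject.ofLE A B h.le)))]
      have : inv (0 : W ⟶ cokernel (Subobject.ofLE A B h.le)) = 0 := by
        rw [← cancel_epi (0 : W ⟶ cokernel (Subobject.ofLE A B h.le)),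
          ← cancel_mono (0 : W ⟶ cokernel (Subobject.ofLE A B h.le))]; simp
      rw [this]; simp
    have : Epi (Subobject.ofLE A B h.le) := Preadditive.epi_of_cokernel_zero hz
    have : IsIso (Subobject.ofLE A B h.le) := isIso_of_mono_of_epi _
    have : B ≤ A := Subobject.le_of_comm (inv (Subobject.ofLE A B h.le)) (by simp)
    exact absurd this h.lt.not_ge
  · let m : pullback g π ⟶ X := pullback.snd g π ≫ B.arrow
    let P := Subobject.mk m
    have hAP : A ≤ P := Subobject.le_mk_of_comm
      (pullback.lift 0 (Subobject.ofLE A B h.le) (by simp [hπ]))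
      (by simp only [m]; rw [← Category.assoc, pullback.lift_snd, Subobject.ofLE_arrow])
    have hPB : P ≤ B := Subobject.mk_le_of_comm (pullback.snd g π) rfl
    rcases h.eq_or_eq hAP hPB with hP | hP
    · exfalso
      apply hg
      have hle : P ≤ A := hP.le
      have h1 : pullback.snd g π = Subobject.ofMkLE m A hle ≫ Subobject.ofLE A B h.le := by
        rw [← cancel_mono B.arrow]
        simp [m]
      rw [← cancel_epi (pullback.fst g π), pullback.condition, h1]
      have h2 : Subobject.ofLE A B h.le ≫ π = 0 := cokernel.condition _
      rw [Category.assoc, h2, comp_zero, comp_zero]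
    · have hle : B ≤ P := hP.ge
      have h1 : Subobject.ofLEMk B m hle ≫ pullback.snd g π = 𝟙 _ := by
        rw [← cancel_mono B.arrow]
        simp only [Category.assoc, Category.id_comp]
        exact Subobject.ofLEMk_comp hle
      have h2 : (Subobject.ofLEMk B m hle ≫ pullback.fst g π) ≫ g = π := by
        rw [Category.assoc, pullback.condition, reassoc_of% h1]
      have : Epi ((Subobject.ofLEMk B m hle ≫ pullback.fst g π) ≫ g) := by
        rw [h2]; infer_instance
      have : Epi g := epi_of_epi (Subobject.ofLEMk B m hle ≫ pullback.fst g π) g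
      exact isIso_of_mono_of_epi g

lemma finiteLength_induction (hfl : FiniteLength C) (P : C → Prop)
    (hiso : ∀ X Y : C, (X ≅ Y) → P X → P Y) (hzero : ∀ X : C, IsZero X → P X)
    (hext : ∀ S : ShortComplex C, S.ShortExact → P S.X₁ → P S.X₃ → P S.X₂)
    (hs : ∀ X : C, Simple X → P X) (X : C) : P X := by
  obtain ⟨n, f, h0, h1, hc⟩ := hfl X
  have key : ∀ i : Fin (n + 1), P (f i : C) := by
    intro i
    induction i using Fin.induction with
    | zero =>
      apply hzero
      rw [h0]
      exact (isZero_zero C).of_iso Subobject.botCoeIsoZero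
    | succ i ih =>
      have hS : (ShortComplex.mk (Subobject.ofLE _ _ (hc i).le) (cokernel.π _)
        (cokernel.condition _)).ShortExact :=
        { exact := ShortComplex.exact_of_g_is_cokernel _ (cokernelIsCokernel _) }
      exact hext _ hS ih (hs _ (simple_cokernel_of_covBy (hc i)))
  have := key (Fin.last n)
  rw [h1] at this
  exact hiso _ _ (asIso (⊤ : Subobject X).arrow) this

end Indec

section Ext

open Pretriangulated DerivedCategory

variable {C : Type u} [Category.{v} C] [Abelian C] [HasDerivedCategory.{w} C]

lemma exists_simple_right (hfl : FiniteLength C) {X Y : C} {d : ℤ} (h : extNonzero C X Y d) :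
    ∃ S : C, Simple S ∧ extNonzero C X S d := by
  by_contra! hcon
  refine finiteLength_induction hfl (fun Z => ¬ extNonzero C X Z d) ?_ ?_ ?_ hcon Y h
  · rintro Z Z' e h ⟨g, hg⟩
    refine h ⟨g ≫ ((singleFunctor C 0).map e.inv)⟦d⟧', fun h0 => hg ?_⟩
    rw [← cancel_mono (((singleFunctor C 0).map e.inv)⟦d⟧'), h0, zero_comp]
  · rintro Z hZ ⟨g, hg⟩
    exact hg ((((shiftFunctor _ d).map_isZero ((singleFunctor C 0).map_isZero hZ))).eq_of_tgt _ _)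
  · rintro S hS h1 h3 ⟨g, hg⟩
    have T := Triangle.shift_distinguished _ hS.singleTriangle_distinguished d
    have hz : ∀ k : (singleFunctor C 0).obj X ⟶ ((singleFunctor C 0).obj S.X₃)⟦d⟧, k = 0 :=
      fun k => by by_contra hk; exact h3 ⟨k, hk⟩
    have hz1 : ∀ k : (singleFunctor C 0).obj X ⟶ ((singleFunctor C 0).obj S.X₁)⟦d⟧, k = 0 :=
      fun k => by by_contra hk; exact h1 ⟨k, hk⟩
    obtain ⟨l, hl⟩ := coyo2 T g (hz _)
    apply hg
    rw [hl]
    have : l = 0 := hz1 l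
    rw [this]
    exact zero_comp

lemma exists_simple_left (hfl : FiniteLength C) {X Y : C} {d : ℤ} (h : extNonzero C X Y d) :
    ∃ S : C, Simple S ∧ extNonzero C S Y d := by
  by_contra! hcon
  refine finiteLength_induction hfl (fun Z => ¬ extNonzero C Z Y d) ?_ ?_ ?_ hcon X h
  · rintro Z Z' e h ⟨g, hg⟩
    refine h ⟨(singleFunctor C 0).map e.hom ≫ g, fun h0 => hg ?_⟩
    rw [← cancel_epi ((singleFunctor C 0).map e.hom), h0, comp_zero]
  · rintro Z hZ ⟨g, hg⟩
    exact hg (((singleFunctor C 0).map_isZero hZ).eq_of_src _ _)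
  · rintro S hS h1 h3 ⟨g, hg⟩
    obtain ⟨δ, T⟩ := ses_triangle _ _ _ hS
    have hz : ∀ k : (singleFunctor C 0).obj S.X₃ ⟶ ((singleFunctor C 0).obj Y)⟦d⟧, k = 0 :=
      fun k => by by_contra hk; exact h3 ⟨k, hk⟩
    have hz1 : ∀ k : (singleFunctor C 0).obj S.X₁ ⟶ ((singleFunctor C 0).obj Y)⟦d⟧, k = 0 :=
      fun k => by by_contra hk; exact h1 ⟨k, hk⟩
    obtain ⟨l, hl⟩ := yo2 T g (hz1 _)
    apply hg
    rw [hl, hz l]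
    simp

lemma extNonzero_zero_of_hom {X Y : C} (g : X ⟶ Y) (hg : g ≠ 0) : extNonzero C X Y 0 := by
  let e := (shiftFunctorZero (DerivedCategory C) ℤ).app ((singleFunctor C 0).obj Y)
  refine ⟨(singleFunctor C 0).map g ≫ e.inv, fun h => hg ?_⟩
  apply (singleFunctor C 0).map_injective
  rw [← cancel_mono e.inv, Functor.map_zero, zero_comp]
  exact h

/-- The degree function attached to a piecewise hereditary category. -/
lemma exists_degree (hph : IsPiecewiseHereditary.{w, w', v, u, v', u'} C) :
    ∃ n : C → ℤ, ∀ X Y : C, Indecomposable X → Indecomposable Y → ∀ d : ℤ,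
      extNonzero C X Y d → n X ≤ n Y + d ∧ n Y + d ≤ n X + 1 := by
  obtain ⟨ℋ, _, _, _, hH, ⟨F⟩⟩ := hph
  have := F.isEquivalence
  letI := F.commShift
  have := F.isTriangulated
  have key : ∀ X : C, ∃ n : ℤ, Indecomposable X → ∃ H : ℋ, Nonempty
      (F.functor.obj ((singleFunctor C 0).obj X) ≅ ((singleFunctor ℋ 0).obj H)⟦n⟧) := by
    intro X
    by_cases hX : Indecomposable X
    · obtain ⟨n, H, hn⟩ := exists_iso_shift hH (F.functor.obj ((singleFunctor C 0).obj X))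
        (by
          intro h
          apply hX.1
          rw [IsZero.iff_id_eq_zero]
          apply (singleFunctor C 0).map_injective
          apply F.functor.map_injective
          exact h.eq_of_src _ _)
        (by
          intro e he
          obtain ⟨e, rfl⟩ := F.functor.map_surjective e
          obtain ⟨e, rfl⟩ := (singleFunctor C 0).map_surjective e
          rcases idem_of_indecomposable hX e (by
            apply (singleFunctor C 0).map_injective
            apply F.functor.map_injective
            simpa using he) with rfl | rfl
          · left; simp
          · right; simp)
      exact ⟨n, fun _ => ⟨H, hn⟩⟩
    · exact ⟨0, fun h => absurd h hX⟩
  choose n hn using key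
  refine ⟨n, fun X Y hX hY d ⟨g, hg⟩ => ?_⟩
  obtain ⟨H, ⟨a⟩⟩ := hn X hX
  obtain ⟨H', ⟨b⟩⟩ := hn Y hY
  let c : F.functor.obj (((singleFunctor C 0).obj Y)⟦d⟧) ≅
      ((singleFunctor ℋ 0).obj H')⟦n Y + d⟧ :=
    (F.functor.commShiftIso d).app _ ≪≫ (shiftFunctor _ d).mapIso b ≪≫
      ((shiftFunctorAdd (DerivedCategory ℋ) (n Y) d).app _).symm
  refine hom_shift_range hH (a.inv ≫ F.functor.map g ≫ c.hom) (fun h => hg ?_)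
  apply F.functor.map_injective
  rw [← cancel_epi a.inv, ← cancel_mono c.hom, Category.assoc, h]
  simp

lemma epsPath_range {n : C → ℤ} (hn : ∀ X Y : C, Indecomposable X → Indecomposable Y → ∀ d : ℤ,
      extNonzero C X Y d → n X ≤ n Y + d ∧ n Y + d ≤ n X + 1)
    {r : ℕ} (ε : Fin r → ℤ) (hε : ∀ i, ε i = 1 ∨ ε i = -1) :
    ∃ α : ℤ, ∀ X Y : C, EpsPath C ε X Y → n X + α ≤ n Y ∧ n Y ≤ n X + α + r := by
  let s : ℕ → ℤ := fun k => ∑ j ∈ Finset.range k, if h : j < r then (if ε ⟨j, h⟩ = 1 then 0 else -1) else 0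
  refine ⟨s r, fun X Y ⟨c, h0, h1, hind, hc⟩ => ?_⟩
  have key : ∀ i : Fin (r + 1), n X + s i ≤ n (c i) ∧ n (c i) ≤ n X + s i + i := by
    intro i
    induction i using Fin.induction with
    | zero => simp [s, h0]
    | succ i ih =>
      have hs : s (i + 1) = s i + if ε i = 1 then 0 else -1 := by
        simp only [s]
        rw [Finset.sum_range_succ]
        simp
      simp only [Fin.val_castSucc, Fin.val_succ] at ih ⊢
      rw [hs]
      rcases hε i with h | h
      · obtain ⟨g, hg⟩ := (hc i).1 h
        have := hn _ _ (hind _) (hind _) 0 (extNonzero_zero_of_hom g hg)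
        simp only [h, if_true]
        push_cast
        omega
      · obtain ⟨g, hg⟩ := (hc i).2 h
        have := hn _ _ (hind _) (hind _) 0 (extNonzero_zero_of_hom g hg)
        have h' : ¬ ε i = 1 := by omega
        simp only [h', if_false]
        push_cast
        omega
  have := key (Fin.last r)
  rw [h1] at this
  simpa using this

end Ext

theorem gldim_le_of_epsPath_to_simples
    (hfl : FiniteLength 𝒜) (hph : IsPiecewiseHereditary.{w, w', v, u, v', u'} 𝒜)
    (r : ℕ) (hr : 1 ≤ r) (ε : Fin r → ℤ) (hε : ∀ i, ε i = 1 ∨ ε i = -1)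
    (Q₀ : 𝒜) (hQ₀ : Indecomposable Q₀)
    (hpath : ∀ S : 𝒜, Simple S → EpsPath 𝒜 ε Q₀ S) :
    gldim 𝒜 ≤ (r : ℕ∞) + 1 ∧
      ∀ Q : 𝒜, Indecomposable Q → projDim 𝒜 Q + injDim 𝒜 Q ≤ (r : ℕ∞) + 2 := by
  obtain ⟨n, hn⟩ := exists_degree hph
  obtain ⟨α, hα⟩ := epsPath_range hn ε hε
  have hsimple : ∀ S : 𝒜, Simple S →
      Indecomposable S ∧ n Q₀ + α ≤ n S ∧ n S ≤ n Q₀ + α + r := by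
    intro S hS
    refine ⟨?_, hα _ _ (hpath S hS)⟩
    obtain ⟨c, -, h1, hind, -⟩ := hpath S hS
    rw [← h1]
    exact hind _
  constructor
  · refine iSup_le fun X => iSup_le fun d => iSup_le fun ⟨Y, h⟩ => ?_
    obtain ⟨S, hS, h⟩ := exists_simple_right hfl h
    obtain ⟨S', hS', h⟩ := exists_simple_left hfl h
    have h1 := hsimple S hS
    have h2 := hsimple S' hS'
    have := hn _ _ h2.1 h1.1 _ h
    have hd : d ≤ r + 1 := by omega
    exact_mod_cast hd
  · intro Q hQ
    have hp : ∀ d : ℕ, (∃ Q' : 𝒜, extNonzero 𝒜 Q Q' d) → (d : ℤ) ≤ n Q - (n Q₀ + α) + 1 := by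
      rintro d ⟨Y, h⟩
      obtain ⟨S, hS, h⟩ := exists_simple_right hfl h
      have h1 := hsimple S hS
      have := hn _ _ hQ h1.1 _ h
      omega
    have hi : ∀ d : ℕ, (∃ Q' : 𝒜, extNonzero 𝒜 Q' Q d) → (d : ℤ) ≤ n Q₀ + α + r - n Q + 1 := by
      rintro d ⟨Y, h⟩
      obtain ⟨S, hS, h⟩ := exists_simple_left hfl h
      have h1 := hsimple S hS
      have := hn _ _ h1.1 hQ _ h
      omega
    have h0 : extNonzero 𝒜 Q Q ((0 : ℕ) : ℤ) :=
      extNonzero_zero_of_hom (𝟙 Q) (fun h => hQ.1 ((IsZero.iff_id_eq_zero Q).2 h))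
    have hp0 := hp 0 ⟨Q, h0⟩
    have hi0 := hi 0 ⟨Q, h0⟩
    have hP : projDim 𝒜 Q ≤ ((n Q - (n Q₀ + α) + 1).toNat : ℕ∞) := by
      refine iSup_le fun d => iSup_le fun h => ?_
      have := hp d h
      have hd : d ≤ (n Q - (n Q₀ + α) + 1).toNat := by omega
      exact_mod_cast hd
    have hI : injDim 𝒜 Q ≤ ((n Q₀ + α + r - n Q + 1).toNat : ℕ∞) := by
      refine iSup_le fun d => iSup_le fun h => ?_
      have := hi d h
      have hd : d ≤ (n Q₀ + α + r - n Q + 1).toNat := by omega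
      exact_mod_cast hd
    refine (add_le_add hP hI).trans ?_
    have : (n Q - (n Q₀ + α) + 1).toNat + (n Q₀ + α + r - n Q + 1).toNat ≤ r + 2 := by omega
    exact_mod_cast this

end PiecewiseHereditaryPaper
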